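/- arXiv:1401.0851 — 7 statements merged into one kernel-verified Lean document; each statement's English description precedes it below -/
import Mathlib

section
/- Consider the GEIM greedy construction applied to linearly independent functions κ₁,…,κ_{k_I} ∈ L²(I) with a dictionary Σ^I that is unisolvent on span{κ₁,…,κ_{k_I}} and for which every argmax over the dictionary is attained. Then: (1) the construction is well-defined, i.e. at every step m the selected functional satisfies |σ_m(r_m)| > 0; (2) the matrix B with entries B_{ij} := σ_i(q_j), 1 ≤ i,j ≤ k_I, is lower triangular with unit diagonal (B_{ij} = 0 for i < j, B_{ii} = 1), hence invertible, and moreover |B_{ij}| ≤ 1 for all 1 ≤ i,j ≤ k_I; (3) the functions q₁,…,q_{k_I} form a basis of the space W^I_{k_I} := span{κ₁,…,κ_{k_I}}. -/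
open scoped RealInnerProductSpace

/-- If each `r m` differs from `κ m` by an element of the span of the earlier `q j`, and each `q m`
is a multiple of `r m`, then `r m - κ m` lies in the span of the earlier `κ j`. -/
lemma sub_mem_span_image_Iio_of_recursion {K V ι : Type*} [Ring K] [AddCommGroup V] [Module K V]
    [Preorder ι] [WellFoundedLT ι] {κ r q : ι → V} {c : ι → K}
    (hrm : ∀ m, r m - κ m ∈ Submodule.span K (q '' {j | j < m}))
    (hq : ∀ m, q m = c m • r m) (m : ι) :
    r m - κ m ∈ Submodule.span K (κ '' {j | j < m}) := by
  induction m using WellFoundedLT.induction with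
  | ind m ih =>
    refine Submodule.span_le.2 ?_ (hrm m)
    rintro _ ⟨j, hj, rfl⟩
    have hsub : r j - κ j ∈ Submodule.span K (κ '' {j | j < m}) :=
      Submodule.span_mono (Set.image_mono fun _ hi => lt_trans hi hj) (ih j hj)
    have hκ : κ j ∈ Submodule.span K (κ '' {j | j < m}) :=
      Submodule.subset_span ⟨j, hj, rfl⟩
    rw [SetLike.mem_coe, hq j]
    exact Submodule.smul_mem _ _ (by simpa using add_mem hsub hκ)

/-- A square matrix that is lower triangular with unit diagonal is invertible. -/
lemma Matrix.isUnit_of_lowerTriangular_of_diag_eq_one {R n : Type*} [CommRing R] [Fintype n]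
    [LinearOrder n] {M : Matrix n n R} (hlow : ∀ i j, i < j → M i j = 0)
    (hdiag : ∀ i, M i i = 1) : IsUnit M := by
  rw [Matrix.isUnit_iff_isUnit_det, Matrix.det_of_isLowerTriangular M fun i j hij => hlow i j hij]
  simp [hdiag]

/-- Vectors with an invertible matrix of values under some linear functionals are linearly
independent. -/
lemma LinearIndependent.of_isUnit_matrix_apply {K V n : Type*} [CommRing K] [AddCommGroup V]
    [Module K V] [Fintype n] [DecidableEq n] {f : n → V →ₗ[K] K} {v : n → V}
    (h : IsUnit (Matrix.of fun i j => f i (v j))) : LinearIndependent K v := by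
  rw [Fintype.linearIndependent_iff]
  intro c hc
  refine congrFun (Matrix.mulVec_injective_of_isUnit h (a₁ := c) (a₂ := 0) ?_)
  ext i
  simpa [Matrix.mulVec, dotProduct, mul_comm] using congrArg (f i) hc

/-- **Well-posedness and basic properties of the GEIM greedy construction.**
`H` models `L²(I)`.  `Dict` is a dictionary of bounded linear functionals of the form
`σ(v) = ⟪v, ς⟫` (i.e. `∫_I v ς`) with `‖ς‖ ≤ 1` (the Riesz representatives have unit
`L²(ω)`-norm, so their restrictions to `I` have norm at most one), assumed unisolvent on
`span{κ₁,…,κ_{k_I}}`.  The greedy data `σ m`, `r m`, `q m` satisfy the defining recursion: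
`r m ∈ κ m + span{q j : j < m}` with `σ i (r m) = 0` for `i < m`, `σ m` maximizes `|·(r m)|`
over the dictionary, and `q m = (σ m (r m))⁻¹ • r m`.  Then:
(1) the construction is well-defined, i.e. `|σ m (r m)| > 0` at every step;
(2) the matrix `B i j = σ i (q j)` is lower triangular with unit diagonal (hence invertible)
and all its entries have absolute value at most `1`;
(3) `q₁,…,q_{k_I}` form a basis of `W^I_{k_I} = span{κ₁,…,κ_{k_I}}`. -/
theorem geim_greedy_well_defined_triangular_basis
    {H : Type*} [NormedAddCommGroup H] [InnerProductSpace ℝ H]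
    (Dict : Set (H →L[ℝ] ℝ))
    (hDict : ∀ σ' ∈ Dict, ∃ ς : H, ‖ς‖ ≤ 1 ∧ ∀ v : H, σ' v = ⟪v, ς⟫)
    (kI : ℕ) (hkI : 0 < kI)
    (κ : Fin kI → H) (hlin : LinearIndependent ℝ κ)
    (huni : ∀ g ∈ Submodule.span ℝ (Set.range κ), (∀ σ' ∈ Dict, σ' g = 0) → g = 0)
    (σ : Fin kI → H →L[ℝ] ℝ) (hσD : ∀ m, σ m ∈ Dict)
    (r q : Fin kI → H)
    (hrm : ∀ m, r m - κ m ∈ Submodule.span ℝ (q '' {j | j < m}))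
    (hortho : ∀ m i, i < m → σ i (r m) = 0)
    (hmax : ∀ m, ∀ τ ∈ Dict, |τ (r m)| ≤ |σ m (r m)|)
    (hq : ∀ m, q m = (σ m (r m))⁻¹ • r m) :
    (∀ m, σ m (r m) ≠ 0) ∧
    (∀ i j, i < j → σ i (q j) = 0) ∧
    (∀ i, σ i (q i) = 1) ∧
    (∀ i j, |σ i (q j)| ≤ 1) ∧
    IsUnit (Matrix.of fun i j => σ i (q j)) ∧
    LinearIndependent ℝ q ∧
    Submodule.span ℝ (Set.range q) = Submodule.span ℝ (Set.range κ) := by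
  have hsub := sub_mem_span_image_Iio_of_recursion hrm hq
  have hrκ (m) : r m ∈ Submodule.span ℝ (Set.range κ) := by
    simpa using add_mem (Submodule.span_mono (Set.image_subset_range _ _) (hsub m))
      (Submodule.subset_span (Set.mem_range_self m))
  have hne (m) : σ m (r m) ≠ 0 := by
    intro h0
    have hr : r m = 0 := huni _ (hrκ m) fun τ hτ => by simpa [h0] using hmax m τ hτ
    have hκ : κ m ∈ Submodule.span ℝ (κ '' {j | j < m}) := by simpa [hr] using hsub m
    exact hlin.notMem_span_image (s := {j | j < m}) (lt_irrefl m) hκ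
  have hlow (i j) (hij : i < j) : σ i (q j) = 0 := by simp [hq j, hortho j i hij]
  have hdiag (i) : σ i (q i) = 1 := by simp [hq i, hne i]
  have hunit : IsUnit (Matrix.of fun i j => σ i (q j)) :=
    Matrix.isUnit_of_lowerTriangular_of_diag_eq_one hlow hdiag
  refine ⟨hne, hlow, hdiag, fun i j => ?_, hunit,
    .of_isUnit_matrix_apply (f := fun i => (σ i : H →ₗ[ℝ] ℝ)) hunit, le_antisymm ?_ ?_⟩
  · rw [hq j, map_smul, smul_eq_mul, abs_mul, abs_inv, inv_mul_le_one₀ (abs_pos.2 (hne j))]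
    exact hmax j _ (hσD i)
  · rw [Submodule.span_le]
    rintro _ ⟨m, rfl⟩
    rw [SetLike.mem_coe, hq m]
    exact Submodule.smul_mem _ _ (hrκ m)
  · rw [Submodule.span_le]
    rintro _ ⟨m, rfl⟩
    have hr : r m = σ m (r m) • q m := by rw [hq m, smul_inv_smul₀ (hne m)]
    have hmem : r m ∈ Submodule.span ℝ (Set.range q) :=
      hr ▸ Submodule.smul_mem _ _ (Submodule.subset_span (Set.mem_range_self m))
    simpa using sub_mem hmem (Submodule.span_mono (Set.image_subset_range _ _) (hrm m))
end

section
/- Consider the GEIM greedy construction applied to linearly independent functions κ₁,…,κ_{k_I} ∈ L²(I) with a dictionary Σ^I that is unisolvent on span{κ₁,…,κ_{k_I}} and for which every argmax over the dictionary is attained. Then the GEIM interpolation is exact on W^I_{k_I} := span{κ₁,…,κ_{k_I}}: for every w ∈ W^I_{k_I}, the interpolant satisfies I^I_{k_I}[w] = w. -/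
open scoped RealInnerProductSpace

/-- A linear combination of `q` annihilated by all `σ i` is trivial when the matrix `σ i (q j)`
is lower triangular with nonzero diagonal. -/
theorem eq_zero_of_lowerTriangular_apply_sum_eq_zero
    {ι R M N : Type*} [Fintype ι] [LinearOrder ι] [Ring R] [NoZeroDivisors R]
    [AddCommGroup M] [Module R M] [FunLike N M R] [LinearMapClass N R M R]
    (σ : ι → N) (q : ι → M) (hdiag : ∀ i, σ i (q i) ≠ 0)
    (hupper : ∀ i j, i < j → σ i (q j) = 0) (c : ι → R)
    (hc : ∀ i, σ i (∑ j, c j • q j) = 0) : c = 0 := by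
  funext i
  induction i using WellFoundedLT.induction with
  | _ i ih =>
    have h := hc i
    rw [map_sum, Finset.sum_eq_single i] at h
    · rw [map_smul, smul_eq_mul] at h
      exact (mul_eq_zero.mp h).resolve_right (hdiag i)
    · intro j _ hj
      rcases lt_or_gt_of_ne hj with hji | hij
      · simp [ih j hji]
      · simp [hupper i j hij]
    · simp

/-- If each `r m` differs from `κ m` by an element of the span of the earlier `q j`, and each `q m`
is a multiple of `r m`, then the earlier `q j` lie in the span of the earlier `κ j`. -/
theorem span_image_Iio_le_of_sub_mem
    {ι R M : Type*} [LinearOrder ι] [WellFoundedLT ι] [Ring R] [AddCommGroup M] [Module R M]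
    {κ r q : ι → M} (hrm : ∀ m, r m - κ m ∈ Submodule.span R (q '' Set.Iio m))
    (hq : ∀ m, ∃ a : R, q m = a • r m) (m : ι) :
    Submodule.span R (q '' Set.Iio m) ≤ Submodule.span R (κ '' Set.Iio m) := by
  induction m using WellFoundedLT.induction with
  | _ m ih =>
    rw [Submodule.span_le]
    rintro _ ⟨j, hj, rfl⟩
    obtain ⟨a, ha⟩ := hq j
    have hsub : r j - κ j ∈ Submodule.span R (κ '' Set.Iio m) :=
      Submodule.span_mono (Set.image_mono (Set.Iio_subset_Iio (le_of_lt hj))) (ih j hj (hrm j))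
    have hκ : κ j ∈ Submodule.span R (κ '' Set.Iio m) :=
      Submodule.subset_span (Set.mem_image_of_mem κ hj)
    rw [ha]
    exact Submodule.smul_mem _ a (by simpa using Submodule.add_mem _ hsub hκ)

/-- **Exactness of the GEIM interpolation on the greedy space.**
In the GEIM greedy setting (`H` models `L²(I)`, `Dict` a dictionary of functionals
`σ(v) = ⟪v, ς⟫` with `‖ς‖ ≤ 1`, unisolvent on `span{κ₁,…,κ_{k_I}}`; greedy data
`σ m`, `r m`, `q m` satisfying the defining recursion with attained argmax), the
interpolation is exact on `W^I_{k_I} = span{κ₁,…,κ_{k_I}}`: for every `w` in the span,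
any coefficient vector `α` solving the interpolation system
`σ i (Σ_j α j • q j) = σ i w` (for all `i`) yields `Σ_j α j • q j = w`,
i.e. `I^I_{k_I}[w] = w`. -/
theorem geim_interpolation_exact_on_span
    {H : Type*} [NormedAddCommGroup H] [InnerProductSpace ℝ H]
    (Dict : Set (H →L[ℝ] ℝ))
    (hDict : ∀ σ' ∈ Dict, ∃ ς : H, ‖ς‖ ≤ 1 ∧ ∀ v : H, σ' v = ⟪v, ς⟫)
    (kI : ℕ) (hkI : 0 < kI)
    (κ : Fin kI → H) (hlin : LinearIndependent ℝ κ)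
    (huni : ∀ g ∈ Submodule.span ℝ (Set.range κ), (∀ σ' ∈ Dict, σ' g = 0) → g = 0)
    (σ : Fin kI → H →L[ℝ] ℝ) (hσD : ∀ m, σ m ∈ Dict)
    (r q : Fin kI → H)
    (hrm : ∀ m, r m - κ m ∈ Submodule.span ℝ (q '' {j | j < m}))
    (hortho : ∀ m i, i < m → σ i (r m) = 0)
    (hmax : ∀ m, ∀ τ ∈ Dict, |τ (r m)| ≤ |σ m (r m)|)
    (hq : ∀ m, q m = (σ m (r m))⁻¹ • r m) :
    ∀ w ∈ Submodule.span ℝ (Set.range κ), ∀ α : Fin kI → ℝ,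
      (∀ i, σ i (∑ j, α j • q j) = σ i w) → (∑ j, α j • q j) = w := by
  have hle := span_image_Iio_le_of_sub_mem hrm fun m => ⟨_, hq m⟩
  have hr_mem : ∀ m, r m ∈ Submodule.span ℝ (Set.range κ) := fun m => by
    have hsub := Submodule.span_mono (Set.image_subset_range κ _) (hle m (hrm m))
    simpa using Submodule.add_mem _ hsub (Submodule.subset_span (Set.mem_range_self m))
  have hr_ne : ∀ m, r m ≠ 0 := fun m h => by
    have hmem := hle m (hrm m)
    rw [h, zero_sub, Submodule.neg_mem_iff] at hmem
    exact hlin.notMem_span_image (Set.self_notMem_Iio) hmem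
  have hσr : ∀ m, σ m (r m) ≠ 0 := fun m h =>
    hr_ne m <| huni _ (hr_mem m) fun τ hτ => by simpa [h] using hmax m τ hτ
  have hκ_mem : ∀ m, κ m ∈ Submodule.span ℝ (Set.range q) := fun m => by
    have hsub := Submodule.span_mono (Set.image_subset_range q _) (hrm m)
    have hr : r m ∈ Submodule.span ℝ (Set.range q) := by
      rw [← smul_inv_smul₀ (hσr m) (r m), ← hq m]
      exact Submodule.smul_mem _ _ (Submodule.subset_span (Set.mem_range_self m))
    simpa using Submodule.sub_mem _ hr hsub
  intro w hw α hα
  have hwq : w ∈ Submodule.span ℝ (Set.range q) :=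
    Submodule.span_le.mpr (Set.range_subset_iff.mpr hκ_mem) hw
  obtain ⟨β, rfl⟩ := (Submodule.mem_span_range_iff_exists_fun ℝ).mp hwq
  have hαβ : α - β = 0 := by
    refine eq_zero_of_lowerTriangular_apply_sum_eq_zero σ q (fun i => ?_) (fun i j hij => ?_) _
      fun i => ?_
    · simp [hq i, hσr i]
    · simp [hq j, hortho j i hij]
    · simp only [Pi.sub_apply, sub_smul, Finset.sum_sub_distrib]
      rw [map_sub, hα i, sub_self]
  rw [sub_eq_zero.mp hαβ]
end

section
/- Consider the GEIM greedy construction applied to linearly independent functions κ₁,…,κ_{k_I} ∈ L²(I) with a dictionary Σ^I that is unisolvent on span{κ₁,…,κ_{k_I}} and for which every argmax over the dictionary is attained. Then there exist unique functions ϑ₁,…,ϑ_{k_I} ∈ W^I_{k_I} := span{κ₁,…,κ_{k_I}} such that σ_i(ϑ_j) = δ_{ij} for all 1 ≤ i,j ≤ k_I, where σ₁,…,σ_{k_I} are the functionals selected by the greedy algorithm. -/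
open scoped RealInnerProductSpace

/-- A linear map `L : V → 𝕜ⁿ` with `dim V = n` is bijective as soon as it is
triangular with nonzero diagonal on some family of `n` vectors. -/
theorem LinearMap.bijective_of_triangular {𝕜 V : Type*} [Field 𝕜] [AddCommGroup V] [Module 𝕜 V]
    [FiniteDimensional 𝕜 V] {n : ℕ} (hV : Module.finrank 𝕜 V = n) (L : V →ₗ[𝕜] Fin n → 𝕜)
    (v : Fin n → V) (hzero : ∀ j i, i < j → L (v j) i = 0) (hdiag : ∀ j, L (v j) j ≠ 0) :
    Function.Bijective L := by
  have htri : (Matrix.of fun j i => L (v j) i).IsUpperTriangular :=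
    fun j i hij => hzero j i hij
  have hunit : IsUnit (Matrix.of fun j i => L (v j) i) := by
    rw [Matrix.isUnit_iff_isUnit_det, Matrix.det_of_isUpperTriangular htri, isUnit_iff_ne_zero]
    exact Finset.prod_ne_zero_iff.mpr fun j _ => hdiag j
  have hli : LinearIndependent 𝕜 fun j => L (v j) :=
    Matrix.linearIndependent_rows_iff_isUnit.mpr hunit
  have hsurj : Function.Surjective L := by
    rw [← LinearMap.range_eq_top, eq_top_iff, ← hli.span_eq_top_of_card_eq_finrank' (by simp),
      Submodule.span_le]
    rintro _ ⟨j, rfl⟩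
    exact ⟨v j, rfl⟩
  exact ⟨(LinearMap.injective_iff_surjective_of_finrank_eq_finrank (by simp [hV])).mpr hsurj, hsurj⟩

/-- If `r m - κ m` is spanned by the earlier `q j`, and every `q m` is a multiple of `r m`, then
every earlier `q j` is spanned by the earlier `κ j`. -/
theorem span_image_lt_le_of_sub_mem {𝕜 V ι : Type*} [Field 𝕜] [AddCommGroup V] [Module 𝕜 V]
    [LinearOrder ι] [WellFoundedLT ι] {κ r q : ι → V}
    (hrm : ∀ m, r m - κ m ∈ Submodule.span 𝕜 (q '' {j | j < m}))
    (hq : ∀ m, ∃ c : 𝕜, q m = c • r m) (m : ι) :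
    Submodule.span 𝕜 (q '' {j | j < m}) ≤ Submodule.span 𝕜 (κ '' {j | j < m}) := by
  induction m using WellFoundedLT.induction with
  | ind m ih =>
    rw [Submodule.span_le]
    rintro _ ⟨j, hj, rfl⟩
    obtain ⟨c, hc⟩ := hq j
    have hsub : r j - κ j ∈ Submodule.span 𝕜 (κ '' {j | j < m}) :=
      Submodule.span_mono (Set.image_mono fun i (hi : i < j) => hi.trans hj) (ih j hj (hrm j))
    have hκ : κ j ∈ Submodule.span 𝕜 (κ '' {j | j < m}) :=
      Submodule.subset_span (Set.mem_image_of_mem κ hj)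
    rw [SetLike.mem_coe, hc]
    exact Submodule.smul_mem _ c ((Submodule.sub_mem_iff_left _ hκ).mp hsub)

/-- **Existence and uniqueness of the cardinal (Lagrange-type) functions for the GEIM.**
In the GEIM greedy setting (`H` models `L²(I)`, `Dict` a dictionary of functionals
`σ(v) = ⟪v, ς⟫` with `‖ς‖ ≤ 1`, unisolvent on `span{κ₁,…,κ_{k_I}}`; greedy data
`σ m`, `r m`, `q m` satisfying the defining recursion with attained argmax), there exist
unique functions `ϑ₁,…,ϑ_{k_I}` in `W^I_{k_I} = span{κ₁,…,κ_{k_I}}` with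
`σ i (ϑ j) = δ_{ij}` for all `1 ≤ i, j ≤ k_I`. -/
theorem geim_cardinal_functions_exist_unique
    {H : Type*} [NormedAddCommGroup H] [InnerProductSpace ℝ H]
    (Dict : Set (H →L[ℝ] ℝ))
    (hDict : ∀ σ' ∈ Dict, ∃ ς : H, ‖ς‖ ≤ 1 ∧ ∀ v : H, σ' v = ⟪v, ς⟫)
    (kI : ℕ) (hkI : 0 < kI)
    (κ : Fin kI → H) (hlin : LinearIndependent ℝ κ)
    (huni : ∀ g ∈ Submodule.span ℝ (Set.range κ), (∀ σ' ∈ Dict, σ' g = 0) → g = 0)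
    (σ : Fin kI → H →L[ℝ] ℝ) (hσD : ∀ m, σ m ∈ Dict)
    (r q : Fin kI → H)
    (hrm : ∀ m, r m - κ m ∈ Submodule.span ℝ (q '' {j | j < m}))
    (hortho : ∀ m i, i < m → σ i (r m) = 0)
    (hmax : ∀ m, ∀ τ ∈ Dict, |τ (r m)| ≤ |σ m (r m)|)
    (hq : ∀ m, q m = (σ m (r m))⁻¹ • r m) :
    ∃! ϑ : Fin kI → H,
      (∀ j, ϑ j ∈ Submodule.span ℝ (Set.range κ)) ∧
      ∀ i j, σ i (ϑ j) = if i = j then (1 : ℝ) else 0 := by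
  have hsub (m) : r m - κ m ∈ Submodule.span ℝ (κ '' {j | j < m}) :=
    span_image_lt_le_of_sub_mem hrm (fun m => ⟨_, hq m⟩) m (hrm m)
  have hr (m) : r m ∈ Submodule.span ℝ (Set.range κ) :=
    (Submodule.sub_mem_iff_left _ (Submodule.subset_span (Set.mem_range_self m))).mp
      (Submodule.span_mono (Set.image_subset_range κ _) (hsub m))
  have hr0 (m) : r m ≠ 0 := fun h0 =>
    hlin.notMem_span_image (s := {j | j < m}) (lt_irrefl m)
      (by simpa [h0] using hsub m)
  have hdiag (m) : σ m (r m) ≠ 0 := fun h0 =>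
    hr0 m <| huni _ (hr m) fun τ hτ => by simpa [h0] using hmax m τ hτ
  let L : Submodule.span ℝ (Set.range κ) →ₗ[ℝ] Fin kI → ℝ :=
    LinearMap.pi fun i => (σ i : H →ₗ[ℝ] ℝ) ∘ₗ Submodule.subtype _
  have hV : Module.finrank ℝ (Submodule.span ℝ (Set.range κ)) = kI := by
    simpa using finrank_span_eq_card hlin
  have : FiniteDimensional ℝ (Submodule.span ℝ (Set.range κ)) :=
    FiniteDimensional.span_of_finite ℝ (Set.finite_range κ)
  have hL : Function.Bijective L :=
    L.bijective_of_triangular hV (fun j => ⟨r j, hr j⟩) hortho hdiag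
  choose ϑ hϑ using fun j : Fin kI => hL.2 fun i => if i = j then 1 else 0
  refine ⟨fun j => ϑ j, ⟨fun j => (ϑ j).2, fun i j => congrFun (hϑ j) i⟩, ?_⟩
  rintro η ⟨hη, hησ⟩
  funext j
  have heq : (⟨η j, hη j⟩ : Submodule.span ℝ (Set.range κ)) = ϑ j :=
    hL.1 ((funext fun i => hησ i j).trans (hϑ j).symm)
  exact congrArg Subtype.val heq
end

section
/- Let H be a real Hilbert space and u₁,…,u_n ∈ H. Define B_n : H → H by B_n v := (1/n) Σ_{i=1}^n ⟨v, u_i⟩ u_i. Then B_n is self-adjoint, nonnegative and of finite rank; denoting its positive eigenvalues in non-increasing order by λ₁ ≥ … ≥ λ_d > 0 with corresponding orthonormal eigenvectors κ₁,…,κ_d, for every k ≤ d the orthogonal projection P_k onto span{κ₁,…,κ_k} satisfies (1/n) Σ_{i=1}^n ‖u_i − P_k u_i‖² = Σ_{l=k+1}^d λ_l, and for every k-dimensional subspace W̃ ⊆ span{u₁,…,u_n} one has (1/n) Σ_{i=1}^n inf_{w ∈ W̃} ‖u_i − w‖² ≥ Σ_{l=k+1}^d λ_l (i.e. the POD space span{κ₁,…,κ_k}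 minimizes the mean squared approximation error of the snapshots). -/
open scoped RealInnerProductSpace

section Orthonormal

variable {H : Type*} [NormedAddCommGroup H] [InnerProductSpace ℝ H]
  {ι : Type*} [Fintype ι] {e : ι → H}

theorem Orthonormal.sum_inner_smul_of_mem_span (he : Orthonormal ℝ e) {x : H}
    (hx : x ∈ Submodule.span ℝ (Set.range e)) : ∑ j, ⟪x, e j⟫ • e j = x := by
  obtain ⟨c, rfl⟩ := (Submodule.mem_span_range_iff_exists_fun ℝ).1 hx
  simp [he.inner_left_fintype]

theorem Orthonormal.norm_sum_smul_sq (he : Orthonormal ℝ e) (c : ι → ℝ) :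
    ‖∑ j, c j • e j‖ ^ 2 = ∑ j, c j ^ 2 := by
  rw [← real_inner_self_eq_norm_sq, he.inner_sum]
  simp [sq]

theorem Orthonormal.sum_inner_sq_le (he : Orthonormal ℝ e) (x : H) :
    ∑ j, ⟪x, e j⟫ ^ 2 ≤ ‖x‖ ^ 2 := by
  simpa [real_inner_comm] using he.sum_inner_products_le x (s := Finset.univ)

/-- Any element of the span of an orthonormal family approximates `x` no better than the
orthogonal projection of `x` does. -/
theorem Orthonormal.norm_sq_sub_sum_inner_sq_le (he : Orthonormal ℝ e) (x : H) {w : H}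
    (hw : w ∈ Submodule.span ℝ (Set.range e)) :
    ‖x‖ ^ 2 - ∑ j, ⟪x, e j⟫ ^ 2 ≤ ‖x - w‖ ^ 2 := by
  have hinner : ⟪x, w⟫ = ∑ j, ⟪w, e j⟫ * ⟪x, e j⟫ := by
    conv_lhs => rw [← he.sum_inner_smul_of_mem_span hw]
    simp [inner_sum, real_inner_smul_right]
  have hnorm : ‖w‖ ^ 2 = ∑ j, ⟪w, e j⟫ ^ 2 := by
    conv_lhs => rw [← he.sum_inner_smul_of_mem_span hw]
    exact he.norm_sum_smul_sq _
  have hsq : 0 ≤ ∑ j, (⟪w, e j⟫ - ⟪x, e j⟫) ^ 2 := Finset.sum_nonneg fun _ _ => sq_nonneg _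
  have hexpand : ∑ j, (⟪w, e j⟫ - ⟪x, e j⟫) ^ 2
      = ∑ j, ⟪w, e j⟫ ^ 2 - 2 * ∑ j, ⟪w, e j⟫ * ⟪x, e j⟫ + ∑ j, ⟪x, e j⟫ ^ 2 := by
    rw [Finset.mul_sum, ← Finset.sum_sub_distrib, ← Finset.sum_add_distrib]
    exact Finset.sum_congr rfl fun _ _ => by ring
  rw [norm_sub_sq_real, hinner, hnorm]
  linarith

end Orthonormal

/-- A weighted sum of nonnegative non-increasing numbers, with weights in `[0, 1]` of total mass
at most `k`, is at most the sum of the first `k` of them. -/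
theorem Antitone.sum_mul_le_sum_ite_lt {d k : ℕ} {lam a : Fin d → ℝ} (hlam : Antitone lam)
    (hnonneg : ∀ l, 0 ≤ lam l) (ha0 : ∀ l, 0 ≤ a l) (ha1 : ∀ l, a l ≤ 1)
    (hsum : ∑ l, a l ≤ k) :
    ∑ l, lam l * a l ≤ ∑ l : Fin d, if (l : ℕ) < k then lam l else 0 := by
  rcases lt_or_ge k d with hk | hk
  · set c := lam ⟨k, hk⟩ with hc
    have hterm : ∀ l : Fin d, lam l * a l - c * a l
        ≤ (if (l : ℕ) < k then lam l else 0) - c * (if (l : ℕ) < k then 1 else 0) := by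
      intro l
      split_ifs with hl
      · have : c ≤ lam l := hlam (Fin.le_def.2 hl.le)
        nlinarith [ha1 l]
      · have : lam l ≤ c := hlam (Fin.le_def.2 (not_lt.1 hl))
        nlinarith [ha0 l]
    have hcard : ∑ l : Fin d, (if (l : ℕ) < k then (1 : ℝ) else 0) = k := by
      rw [Finset.sum_boole, Fin.card_filter_val_lt, min_eq_right hk.le]
    have htotal := Finset.sum_le_sum fun l (_ : l ∈ Finset.univ) => hterm l
    rw [Finset.sum_sub_distrib, Finset.sum_sub_distrib, ← Finset.mul_sum, ← Finset.mul_sum,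
      hcard] at htotal
    have := mul_le_mul_of_nonneg_left hsum (hnonneg ⟨k, hk⟩)
    linarith
  · refine Finset.sum_le_sum fun l _ => ?_
    rw [if_pos (l.2.trans_le hk)]
    exact mul_le_of_le_one_right (hnonneg l) (ha1 l)

section Correlation

variable {H : Type*} [NormedAddCommGroup H] [InnerProductSpace ℝ H] {n : ℕ} {u : Fin n → H}
  {d : ℕ} {lam : Fin d → ℝ} {κ : Fin d → H}

theorem inner_correlation (u : Fin n → H) (v w : H) :
    ⟪(n : ℝ)⁻¹ • ∑ i, ⟪v, u i⟫ • u i, w⟫ = (n : ℝ)⁻¹ * ∑ i, ⟪u i, v⟫ * ⟪u i, w⟫ := by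
  simp [real_inner_smul_left, sum_inner, real_inner_comm v]

theorem mean_inner_sq_eigenvector (horth : Orthonormal ℝ κ)
    (heig : ∀ l, ((n : ℝ)⁻¹ • ∑ i, ⟪κ l, u i⟫ • u i) = lam l • κ l) (l : Fin d) :
    (n : ℝ)⁻¹ * ∑ i, ⟪u i, κ l⟫ ^ 2 = lam l := by
  simp only [sq]
  rw [← inner_correlation, heig, real_inner_smul_left, real_inner_self_eq_norm_sq,
    horth.norm_eq_one]
  simp

/-- Spectral expansion of the quadratic form of the empirical correlation operator. -/
theorem mean_inner_sq_eq_sum (horth : Orthonormal ℝ κ)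
    (heig : ∀ l, ((n : ℝ)⁻¹ • ∑ i, ⟪κ l, u i⟫ • u i) = lam l • κ l)
    (hu : ∀ i, u i ∈ Submodule.span ℝ (Set.range κ)) (v : H) :
    (n : ℝ)⁻¹ * ∑ i, ⟪u i, v⟫ ^ 2 = ∑ l, lam l * ⟪κ l, v⟫ ^ 2 := by
  have hexp : ∀ i, ⟪u i, v⟫ = ∑ l, ⟪u i, κ l⟫ * ⟪κ l, v⟫ := fun i => by
    conv_lhs => rw [← horth.sum_inner_smul_of_mem_span (hu i)]
    simp [sum_inner, real_inner_smul_left]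
  calc (n : ℝ)⁻¹ * ∑ i, ⟪u i, v⟫ ^ 2
      = (n : ℝ)⁻¹ * ∑ i, ⟪u i, v⟫ * ∑ l, ⟪u i, κ l⟫ * ⟪κ l, v⟫ := by
        simp only [← hexp, sq]
    _ = ∑ l, ⟪κ l, v⟫ * ((n : ℝ)⁻¹ * ∑ i, ⟪u i, κ l⟫ * ⟪u i, v⟫) := by
        simp only [Finset.mul_sum]
        rw [Finset.sum_comm]
        exact Finset.sum_congr rfl fun _ _ => Finset.sum_congr rfl fun _ _ => by ring
    _ = ∑ l, lam l * ⟪κ l, v⟫ ^ 2 := by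
        refine Finset.sum_congr rfl fun l _ => ?_
        rw [← inner_correlation, heig, real_inner_smul_left]
        ring

theorem mean_norm_sq_sub_partial_sum (horth : Orthonormal ℝ κ)
    (heig : ∀ l, ((n : ℝ)⁻¹ • ∑ i, ⟪κ l, u i⟫ • u i) = lam l • κ l)
    (hu : ∀ i, u i ∈ Submodule.span ℝ (Set.range κ)) (k : ℕ) :
    (n : ℝ)⁻¹ * ∑ i, ‖u i - ∑ l : Fin d, (if (l : ℕ) < k then ⟪u i, κ l⟫ • κ l else 0)‖ ^ 2
      = ∑ l : Fin d, (if k ≤ (l : ℕ) then lam l else 0) := by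
  have hres : ∀ i, ‖u i - ∑ l : Fin d, (if (l : ℕ) < k then ⟪u i, κ l⟫ • κ l else 0)‖ ^ 2
      = ∑ l : Fin d, if k ≤ (l : ℕ) then ⟪u i, κ l⟫ ^ 2 else 0 := by
    intro i
    have htail : u i - ∑ l : Fin d, (if (l : ℕ) < k then ⟪u i, κ l⟫ • κ l else 0)
        = ∑ l : Fin d, (if k ≤ (l : ℕ) then ⟪u i, κ l⟫ else 0) • κ l := by
      conv_lhs => enter [1]; rw [← horth.sum_inner_smul_of_mem_span (hu i)]
      rw [← Finset.sum_sub_distrib]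
      refine Finset.sum_congr rfl fun l _ => ?_
      by_cases hl : (l : ℕ) < k
      · simp [hl, not_le.2 hl]
      · simp [hl, not_lt.1 hl]
    rw [htail, horth.norm_sum_smul_sq]
    exact Finset.sum_congr rfl fun l _ => by split_ifs <;> simp
  simp only [hres]
  rw [Finset.sum_comm, Finset.mul_sum]
  refine Finset.sum_congr rfl fun l _ => ?_
  split_ifs
  · exact mean_inner_sq_eigenvector horth heig l
  · simp

theorem sum_tail_le_mean_norm_sq_sub (horth : Orthonormal ℝ κ)
    (heig : ∀ l, ((n : ℝ)⁻¹ • ∑ i, ⟪κ l, u i⟫ • u i) = lam l • κ l)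
    (hnonneg : ∀ l, 0 ≤ lam l) (hlam : Antitone lam)
    (hu : ∀ i, u i ∈ Submodule.span ℝ (Set.range κ)) {k : ℕ} {e : Fin k → H}
    (he : Orthonormal ℝ e) {w : Fin n → H} (hw : ∀ i, w i ∈ Submodule.span ℝ (Set.range e)) :
    ∑ l : Fin d, (if k ≤ (l : ℕ) then lam l else 0) ≤ (n : ℝ)⁻¹ * ∑ i, ‖u i - w i‖ ^ 2 := by
  have hnorm : (n : ℝ)⁻¹ * ∑ i, ‖u i‖ ^ 2 = ∑ l, lam l := by
    simpa using mean_norm_sq_sub_partial_sum horth heig hu 0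
  have hproj : (n : ℝ)⁻¹ * ∑ i, ∑ j, ⟪u i, e j⟫ ^ 2 = ∑ l, lam l * ∑ j, ⟪κ l, e j⟫ ^ 2 := by
    simp only [Finset.mul_sum (s := (Finset.univ : Finset (Fin k)))]
    rw [Finset.sum_comm, Finset.mul_sum, Finset.sum_comm (s := (Finset.univ : Finset (Fin d)))]
    exact Finset.sum_congr rfl fun j _ => mean_inner_sq_eq_sum horth heig hu (e j)
  have hmass : ∑ l, ∑ j, ⟪κ l, e j⟫ ^ 2 ≤ k := by
    rw [Finset.sum_comm]
    calc ∑ j, ∑ l, ⟪κ l, e j⟫ ^ 2 ≤ ∑ _j : Fin k, (1 : ℝ) := by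
          refine Finset.sum_le_sum fun j _ => ?_
          simpa [real_inner_comm, he.norm_eq_one j] using horth.sum_inner_sq_le (e j)
      _ = k := by simp
  have hhead := hlam.sum_mul_le_sum_ite_lt hnonneg
    (fun l => Finset.sum_nonneg fun j _ => sq_nonneg ⟪κ l, e j⟫)
    (fun l => by simpa [horth.norm_eq_one l] using he.sum_inner_sq_le (κ l)) hmass
  have hsplit : ∑ l, lam l = ∑ l : Fin d, (if (l : ℕ) < k then lam l else 0)
      + ∑ l : Fin d, (if k ≤ (l : ℕ) then lam l else 0) := by
    rw [← Finset.sum_add_distrib]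
    refine Finset.sum_congr rfl fun l _ => ?_
    by_cases hl : (l : ℕ) < k
    · simp [hl, not_le.2 hl]
    · simp [hl, not_lt.1 hl]
  have hbest : (n : ℝ)⁻¹ * ∑ i, (‖u i‖ ^ 2 - ∑ j, ⟪u i, e j⟫ ^ 2)
      ≤ (n : ℝ)⁻¹ * ∑ i, ‖u i - w i‖ ^ 2 :=
    mul_le_mul_of_nonneg_left
      (Finset.sum_le_sum fun i _ => he.norm_sq_sub_sum_inner_sq_le (u i) (hw i)) (by positivity)
  rw [Finset.sum_sub_distrib, mul_sub, hnorm, hproj] at hbest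
  linarith

end Correlation

theorem Submodule.exists_orthonormal_span_eq {H : Type*} [NormedAddCommGroup H]
    [InnerProductSpace ℝ H] (W : Submodule ℝ H) [FiniteDimensional ℝ W] :
    ∃ e : Fin (Module.finrank ℝ W) → H,
      Orthonormal ℝ e ∧ Submodule.span ℝ (Set.range e) = W := by
  set b := stdOrthonormalBasis ℝ W
  refine ⟨W.subtypeₗᵢ ∘ b, b.orthonormal.comp_linearIsometry W.subtypeₗᵢ, ?_⟩
  have hb : Submodule.span ℝ (Set.range b) = ⊤ := by
    rw [← b.coe_toBasis]
    exact b.toBasis.span_eq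
  calc Submodule.span ℝ (Set.range (W.subtypeₗᵢ ∘ b))
      = (Submodule.span ℝ (Set.range b)).map W.subtype := by
        rw [Submodule.map_span, Set.range_comp]
        rfl
    _ = W := by rw [hb, Submodule.map_top, Submodule.range_subtype]

/-- **POD optimality of the eigenspaces of the empirical correlation operator.**
Let `H` be a real Hilbert space and `u₁,…,u_n ∈ H`, and define
`B_n v := (1/n) Σ_i ⟪v, u_i⟫ u_i`.  Then `B_n` is self-adjoint, nonnegative, and of finite
rank.  Denoting its positive eigenvalues in non-increasing order by `λ₁ ≥ … ≥ λ_d > 0`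
with corresponding orthonormal eigenvectors `κ₁,…,κ_d` (which span `span{u₁,…,u_n}`),
for every `k ≤ d`, the orthogonal projection `P_k` onto `span{κ₁,…,κ_k}` satisfies
`(1/n) Σ_i ‖u_i − P_k u_i‖² = Σ_{l=k+1}^d λ_l`, and every `k`-dimensional subspace
`W̃ ⊆ span{u₁,…,u_n}` satisfies `(1/n) Σ_i inf_{w ∈ W̃} ‖u_i − w‖² ≥ Σ_{l=k+1}^d λ_l`
(expressed below as: every choice of approximants `w i ∈ W̃` has mean squared error at
least the eigenvalue tail), i.e. the POD space minimizes the mean squared error. -/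
theorem pod_projection_error_and_optimality
    {H : Type*} [NormedAddCommGroup H] [InnerProductSpace ℝ H]
    (n : ℕ) (hn : 0 < n) (u : Fin n → H)
    (d : ℕ) (lam : Fin d → ℝ) (κ : Fin d → H)
    (horth : Orthonormal ℝ κ)
    (heig : ∀ l, ((n : ℝ)⁻¹ • ∑ i, ⟪κ l, u i⟫ • u i) = lam l • κ l)
    (hpos : ∀ l, 0 < lam l)
    (hdec : ∀ l m : Fin d, l ≤ m → lam m ≤ lam l)
    (hspan : Submodule.span ℝ (Set.range κ) = Submodule.span ℝ (Set.range u)) :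
    -- B_n is self-adjoint
    (∀ v w : H, ⟪(n : ℝ)⁻¹ • ∑ i, ⟪v, u i⟫ • u i, w⟫
        = ⟪v, (n : ℝ)⁻¹ • ∑ i, ⟪w, u i⟫ • u i⟫) ∧
    -- B_n is nonnegative
    (∀ v : H, 0 ≤ ⟪(n : ℝ)⁻¹ • ∑ i, ⟪v, u i⟫ • u i, v⟫) ∧
    -- B_n has finite rank
    (∃ S : Submodule ℝ H, FiniteDimensional ℝ S ∧
      ∀ v : H, ((n : ℝ)⁻¹ • ∑ i, ⟪v, u i⟫ • u i) ∈ S) ∧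
    -- exact mean squared projection error onto the first k POD modes
    (∀ k, k ≤ d →
      (n : ℝ)⁻¹ * ∑ i, ‖u i - ∑ l : Fin d, (if (l : ℕ) < k then ⟪u i, κ l⟫ • κ l else 0)‖ ^ 2
        = ∑ l : Fin d, (if k ≤ (l : ℕ) then lam l else 0)) ∧
    -- POD optimality among all k-dimensional subspaces of the snapshot span
    (∀ k, k ≤ d → ∀ Wt : Submodule ℝ H, Wt ≤ Submodule.span ℝ (Set.range u) →
      Module.finrank ℝ Wt = k → ∀ w : Fin n → H, (∀ i, w i ∈ Wt) →
        (∑ l : Fin d, (if k ≤ (l : ℕ) then lam l else 0))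
          ≤ (n : ℝ)⁻¹ * ∑ i, ‖u i - w i‖ ^ 2) := by
  have hu : ∀ i, u i ∈ Submodule.span ℝ (Set.range κ) := fun i =>
    hspan ▸ Submodule.subset_span (Set.mem_range_self i)
  refine ⟨fun v w => ?_, fun v => ?_, ?_, fun k _ => ?_, fun k _ Wt hWt hk w hw => ?_⟩
  · rw [real_inner_comm _ v, inner_correlation, inner_correlation]
    simp only [mul_comm]
  · rw [inner_correlation]
    exact mul_nonneg (by positivity) (Finset.sum_nonneg fun i _ => mul_self_nonneg _)
  · exact ⟨Submodule.span ℝ (Set.range u), FiniteDimensional.span_of_finite ℝ (Set.finite_range u),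
      fun v => Submodule.smul_mem _ _ (Submodule.sum_mem _ fun i _ =>
        Submodule.smul_mem _ _ (Submodule.subset_span (Set.mem_range_self i)))⟩
  · exact mean_norm_sq_sub_partial_sum horth heig hu k
  · have := FiniteDimensional.span_of_finite ℝ (Set.finite_range u)
    have : FiniteDimensional ℝ Wt := Submodule.finiteDimensional_of_le hWt
    obtain ⟨e, he, hspan_e⟩ := Wt.exists_orthonormal_span_eq
    subst hk
    exact sum_tail_le_mean_norm_sq_sub horth heig (fun l => (hpos l).le)
      (fun l m hlm => hdec l m hlm) hu he fun i => hspan_e.symm ▸ hw i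
end

section
/- (Convergence of the adaptive EPM.) Suppose that for every I ∈ 𝔍 and every l = 1,…,k the restriction κ_lⁿ|_I belongs to the local space W^I_{k_I}, and let Λ^I_{k_I} denote the Lebesgue constant of I^I_{k_I}, i.e. its operator norm on L²(I). Then the integration error satisfies e_int^{1/2} ≤ √k · (1 + (Σ_{I∈𝔍} (Λ^I_{k_I})²)^{1/2}) · (Σ_{l=k+1}^{d(n)} λ_lⁿ)^{1/2}. -/
open scoped RealInnerProductSpace

/-- **Pythagoras** for a finite linear combination of an orthonormal family. -/
lemma Orthonormal.norm_sq_sum_smul {H κι : Type*} [NormedAddCommGroup H] [InnerProductSpace ℝ H]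
    [Fintype κι] {κ : κι → H} (hκ : Orthonormal ℝ κ) (a : κι → ℝ) :
    ‖∑ l, a l • κ l‖ ^ 2 = ∑ l, a l ^ 2 := by
  rw [← real_inner_self_eq_norm_sq, hκ.inner_sum]
  simp [sq]

/-- Truncating the expansion of a vector in an orthonormal family does not increase the norm. -/
lemma Orthonormal.norm_sum_ite_inner_smul_le {H κι : Type*} [NormedAddCommGroup H]
    [InnerProductSpace ℝ H] [Fintype κι] {κ : κι → H} (hκ : Orthonormal ℝ κ)
    (p : κι → Prop) [DecidablePred p] (v : H) :
    ‖∑ l, if p l then ⟪v, κ l⟫ • κ l else 0‖ ≤ ‖v‖ := by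
  have h : (∑ l, if p l then ⟪v, κ l⟫ • κ l else 0)
      = ∑ l, (if p l then ⟪v, κ l⟫ else 0) • κ l :=
    Finset.sum_congr rfl fun l _ => by split_ifs <;> simp
  rw [h]
  refine le_of_sq_le_sq ?_ (norm_nonneg _)
  rw [hκ.norm_sq_sum_smul]
  refine le_trans (Finset.sum_le_sum fun l _ => ?_) (hκ.sum_inner_products_le v (s := Finset.univ))
  rw [real_inner_comm, Real.norm_eq_abs, sq_abs]
  split_ifs
  · exact le_rfl
  · simpa using sq_nonneg ⟪κ l, v⟫

/-- A vector in the span of an orthonormal family equals its expansion. -/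
lemma Orthonormal.sum_inner_smul_of_mem_span_s8 {H κι : Type*} [NormedAddCommGroup H]
    [InnerProductSpace ℝ H] [Fintype κι] {κ : κι → H} (hκ : Orthonormal ℝ κ) {v : H}
    (hv : v ∈ Submodule.span ℝ (Set.range κ)) : ∑ l, ⟪κ l, v⟫ • κ l = v := by
  obtain ⟨c, rfl⟩ := (Submodule.mem_span_range_iff_exists_fun ℝ).1 hv
  exact Finset.sum_congr rfl fun l _ => by rw [hκ.inner_right_fintype]

/-- Symmetric idempotents that sum to the identity split the squared norm. -/
lemma sum_norm_sq_of_sum_symmetric_idempotent {H ι : Type*} [NormedAddCommGroup H]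
    [InnerProductSpace ℝ H] [Fintype ι] {R : ι → H →L[ℝ] H}
    (hRsa : ∀ I (v w : H), ⟪R I v, w⟫ = ⟪v, R I w⟫)
    (hRidem : ∀ I (v : H), R I (R I v) = R I v)
    (hRsum : ∀ v : H, ∑ I, R I v = v) (v : H) : ∑ I, ‖R I v‖ ^ 2 = ‖v‖ ^ 2 := by
  calc ∑ I, ‖R I v‖ ^ 2 = ∑ I, ⟪R I v, v⟫ := Finset.sum_congr rfl fun I _ => by
        rw [← real_inner_self_eq_norm_sq, ← hRsa, hRidem]
    _ = ‖v‖ ^ 2 := by rw [← sum_inner, hRsum, real_inner_self_eq_norm_sq]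

/-- The sum of operators with values in the ranges of mutually orthogonal projections is bounded
by the `ℓ²` norm of the operator norms. -/
lemma norm_sum_apply_le_sqrt_sum_opNorm_sq {H ι : Type*} [NormedAddCommGroup H]
    [InnerProductSpace ℝ H] [Fintype ι] {R A : ι → H →L[ℝ] H}
    (hRsa : ∀ I (v w : H), ⟪R I v, w⟫ = ⟪v, R I w⟫)
    (hRidem : ∀ I (v : H), R I (R I v) = R I v)
    (hRdisj : ∀ I J, I ≠ J → ∀ v : H, R I (R J v) = 0)
    (hRsum : ∀ v : H, ∑ I, R I v = v)
    (hA : ∀ I (v : H), R I (A I v) = A I v) (v : H) :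
    ‖∑ J, A J v‖ ≤ √(∑ I, ‖A I‖ ^ 2) * ‖v‖ := by
  have hR : ∀ I, R I (∑ J, A J v) = A I v := fun I => by
    rw [map_sum, Finset.sum_eq_single I, hA]
    · intro J _ hJ
      rw [← hA J, hRdisj I J hJ.symm]
    · simp
  refine le_of_sq_le_sq ?_ (by positivity)
  rw [← sum_norm_sq_of_sum_symmetric_idempotent hRsa hRidem hRsum, mul_pow,
    Real.sq_sqrt (by positivity), Finset.sum_mul]
  refine Finset.sum_le_sum fun I _ => ?_
  rw [hR, ← mul_pow]
  gcongr
  exact (A I).le_opNorm v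

/-- The mean squared coefficient of the snapshots along a unit eigenvector of the empirical
correlation operator is the eigenvalue. -/
lemma mean_inner_sq_eq_eigenvalue {H : Type*} [NormedAddCommGroup H] [InnerProductSpace ℝ H]
    {n : ℕ} {u : Fin n → H} {e : H} {c : ℝ} (he : ‖e‖ = 1)
    (heig : ((n : ℝ)⁻¹ • ∑ i, ⟪e, u i⟫ • u i) = c • e) :
    (n : ℝ)⁻¹ * ∑ i, ⟪e, u i⟫ ^ 2 = c := by
  have h := congrArg (fun x => ⟪e, x⟫) heig
  simpa [inner_smul_right, inner_sum, real_inner_self_eq_norm_sq, he, sq] using h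

/-- **Convergence bound for the adaptive Empirical Projection Method.**
`H` models `L²(ω)` and `u i = u(μ_i, ·)` are the `n` snapshots.  The empirical correlation
operator `B_n v = (1/n) Σ_i ⟪v, u i⟫ u i` has orthonormal eigenfunctions `κ l` with
positive, non-increasing eigenvalues `lam l`, spanning the snapshot span.  The finite
partition `𝔍` of `ω` is modelled by a finite index type `ι` with orthogonal restriction
projections `R I` summing to the identity; on each cell, `Ip I` is a bounded linear local
interpolation operator onto the finite-dimensional local space `W I` (supported in `I`,
depending only on the restriction to `I`, and reproducing `W I`), whose operator norm
`‖Ip I‖` is the Lebesgue constant `Λ^I_{k_I}`.  Assume that the restriction `R I (κ l)` of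
each of the first `k` eigenfunctions to each cell `I` lies in `W I`.  Then the integration
error `e_int = Σ_I (1/n) Σ_i ‖Σ_{l<k} ⟪u i − I_L[u i], κ l⟫ κ l‖²_{L²(I)}` (with global
interpolant `I_L = Σ_J Ip J`) satisfies
`e_int^{1/2} ≤ √k (1 + (Σ_I (Λ^I)²)^{1/2}) (Σ_{l>k} lam l)^{1/2}`. -/
theorem adaptive_epm_integration_error_bound
    {H : Type*} [NormedAddCommGroup H] [InnerProductSpace ℝ H] [CompleteSpace H]
    -- snapshots
    (n : ℕ) (hn : 0 < n) (u : Fin n → H)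
    -- eigen-decomposition of the empirical correlation operator Bₙ
    (d : ℕ) (lam : Fin d → ℝ) (κ : Fin d → H)
    (horth : Orthonormal ℝ κ)
    (heig : ∀ l, ((n : ℝ)⁻¹ • ∑ i, ⟪κ l, u i⟫ • u i) = lam l • κ l)
    (hpos : ∀ l, 0 < lam l)
    (hdec : ∀ l m : Fin d, l ≤ m → lam m ≤ lam l)
    (hspan : Submodule.span ℝ (Set.range κ) = Submodule.span ℝ (Set.range u))
    (k : ℕ) (hk : k ≤ d)
    -- the partition of ω: orthogonal restriction projections summing to the identity
    {ι : Type*} [Fintype ι]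
    (R : ι → H →L[ℝ] H)
    (hRsa : ∀ I (v w : H), ⟪R I v, w⟫ = ⟪v, R I w⟫)
    (hRidem : ∀ I (v : H), R I (R I v) = R I v)
    (hRdisj : ∀ I J, I ≠ J → ∀ v : H, R I (R J v) = 0)
    (hRsum : ∀ v : H, ∑ I, R I v = v)
    -- local interpolation spaces and operators
    (W : ι → Submodule ℝ H) (hWfin : ∀ I, FiniteDimensional ℝ (W I))
    (hWloc : ∀ I, ∀ w ∈ W I, R I w = w)
    (Ip : ι → H →L[ℝ] H)
    (hIrange : ∀ I (v : H), Ip I v ∈ W I)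
    (hIloc : ∀ I (v : H), Ip I (R I v) = Ip I v)
    (hIproj : ∀ I, ∀ w ∈ W I, Ip I w = w)
    -- the first k eigenfunctions, restricted to each cell, lie in the local spaces
    (hκW : ∀ I (l : Fin d), (l : ℕ) < k → R I (κ l) ∈ W I) :
    Real.sqrt (∑ I, (n : ℝ)⁻¹ * ∑ i, ‖R I (∑ l : Fin d,
        if (l : ℕ) < k then ⟪u i - ∑ J, Ip J (u i), κ l⟫ • κ l else 0)‖ ^ 2)
      ≤ Real.sqrt k * (1 + Real.sqrt (∑ I, ‖Ip I‖ ^ 2)) *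
        Real.sqrt (∑ l : Fin d, if k ≤ (l : ℕ) then lam l else 0) := by
  set c : ℝ := 1 + √(∑ I, ‖Ip I‖ ^ 2) with hc
  set T : ℝ := ∑ l : Fin d, if k ≤ (l : ℕ) then lam l else 0 with hT
  have hc0 : 0 ≤ c := by positivity
  rcases Nat.eq_zero_or_pos k with rfl | hkpos
  · simp
  let w : Fin n → H := fun i => ∑ l : Fin d, (if k ≤ (l : ℕ) then ⟪κ l, u i⟫ else 0) • κ l
  have hw : (n : ℝ)⁻¹ * ∑ i, ‖w i‖ ^ 2 = T := by
    simp only [w, horth.norm_sq_sum_smul]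
    rw [Finset.sum_comm, Finset.mul_sum, hT]
    refine Finset.sum_congr rfl fun l _ => ?_
    split_ifs
    · exact mean_inner_sq_eq_eigenvalue (horth.1 l) (heig l)
    · simp
  have hres : ∀ i, u i - ∑ J, Ip J (u i) = w i - ∑ J, Ip J (w i) := by
    intro i
    have hrepr : ∀ l : Fin d, (l : ℕ) < k → ∑ J, Ip J (κ l) = κ l := fun l hl => by
      conv_rhs => rw [← hRsum (κ l)]
      exact Finset.sum_congr rfl fun J _ => by rw [← hIloc, hIproj J _ (hκW J l hl)]
    have hdiff : u i - w i = ∑ l : Fin d, (if k ≤ (l : ℕ) then 0 else ⟪κ l, u i⟫) • κ l := by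
      conv_lhs => rw [← horth.sum_inner_smul_of_mem_span_s8
        (hspan ▸ Submodule.subset_span (Set.mem_range_self i) : u i ∈ _)]
      simp only [w]
      rw [← Finset.sum_sub_distrib]
      exact Finset.sum_congr rfl fun l _ => by split_ifs <;> simp
    have hfix : ∑ J, Ip J (u i - w i) = u i - w i := by
      rw [hdiff]
      simp only [map_sum, map_smul]
      rw [Finset.sum_comm]
      refine Finset.sum_congr rfl fun l _ => ?_
      rw [← Finset.smul_sum]
      split_ifs with hl
      · simp
      · rw [hrepr l (not_le.1 hl)]
    simp only [map_sub, Finset.sum_sub_distrib] at hfix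
    rw [sub_eq_sub_iff_sub_eq_sub, hfix]
  have hbound : ∀ i, ‖∑ l : Fin d, if (l : ℕ) < k then
      ⟪u i - ∑ J, Ip J (u i), κ l⟫ • κ l else 0‖ ≤ c * ‖w i‖ := by
    intro i
    refine (horth.norm_sum_ite_inner_smul_le (fun l : Fin d => (l : ℕ) < k) _).trans ?_
    rw [hres, hc, add_mul, one_mul]
    refine (norm_sub_le _ _).trans ?_
    gcongr
    exact norm_sum_apply_le_sqrt_sum_opNorm_sq hRsa hRidem hRdisj hRsum
      (fun I v => hWloc I _ (hIrange I v)) (w i)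
  have hsqrt : (1 : ℝ) ≤ √k := Real.one_le_sqrt.2 (by exact_mod_cast hkpos)
  have hmain : ∑ I, (n : ℝ)⁻¹ * ∑ i, ‖R I (∑ l : Fin d,
      if (l : ℕ) < k then ⟪u i - ∑ J, Ip J (u i), κ l⟫ • κ l else 0)‖ ^ 2 ≤ c ^ 2 * T := by
    rw [← Finset.mul_sum, Finset.sum_comm]
    simp only [sum_norm_sq_of_sum_symmetric_idempotent hRsa hRidem hRsum]
    rw [← hw, mul_left_comm, Finset.mul_sum _ _ (c ^ 2)]
    gcongr with i
    rw [← mul_pow]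
    gcongr
    exact hbound i
  calc _ ≤ √(c ^ 2 * T) := Real.sqrt_le_sqrt hmain
    _ = 1 * c * √T := by rw [Real.sqrt_mul (sq_nonneg c), Real.sqrt_sq hc0, one_mul]
    _ ≤ √k * c * √T := by gcongr
end

section
/- (Brezzi–Rappaz–Raviart a posteriori error bound.) Assume the Banach-space setting below with R ≥ β/L. If τ := 2L(r₁ + r₂)/β² < 1, then there exists a unique p ∈ B̄(p₀, β/L) with F(p) = 0, and it satisfies the error bound ‖p − p₀‖_X ≤ (β/L)(1 − √(1 − τ)). -/
/-- If the derivative of `G` grows at most linearly away from `c` on a closed ball around `c`, then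
`G` satisfies a mean value inequality on that ball whose constant is governed by the average of
the distances of the endpoints to `c`. -/
theorem norm_image_sub_le_of_norm_fderiv_le_mul_norm_sub
    {X Y : Type*} [NormedAddCommGroup X] [NormedSpace ℝ X]
    [NormedAddCommGroup Y] [NormedSpace ℝ Y]
    {c : X} {R L : ℝ} (hL : 0 ≤ L) {G : X → Y} {G' : X → X →L[ℝ] Y}
    (hG : ∀ w ∈ Metric.closedBall c R, HasFDerivAt G (G' w) w)
    (hbound : ∀ w ∈ Metric.closedBall c R, ‖G' w‖ ≤ L * ‖w - c‖)
    {x y : X} {a b : ℝ} (hx : ‖x - c‖ ≤ a) (hy : ‖y - c‖ ≤ b) (ha : a ≤ R) (hb : b ≤ R) :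
    ‖G y - G x‖ ≤ L * ((a + b) / 2) * ‖y - x‖ := by
  have hnorm : ∀ t ∈ Set.Icc (0 : ℝ) 1, ‖x + t • (y - x) - c‖ ≤ (1 - t) * a + t * b := by
    intro t ht
    have h0 : 0 ≤ 1 - t := sub_nonneg.2 ht.2
    calc ‖x + t • (y - x) - c‖ = ‖(1 - t) • (x - c) + t • (y - c)‖ := by
          congr 1; module
      _ ≤ ‖(1 - t) • (x - c)‖ + ‖t • (y - c)‖ := norm_add_le _ _
      _ = (1 - t) * ‖x - c‖ + t * ‖y - c‖ := by
          rw [norm_smul_of_nonneg h0, norm_smul_of_nonneg ht.1]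
      _ ≤ (1 - t) * a + t * b :=
          add_le_add (mul_le_mul_of_nonneg_left hx h0) (mul_le_mul_of_nonneg_left hy ht.1)
  have hmem : ∀ t ∈ Set.Icc (0 : ℝ) 1, x + t • (y - x) ∈ Metric.closedBall c R := by
    intro t ht
    rw [mem_closedBall_iff_norm]
    refine (hnorm t ht).trans ?_
    nlinarith [ht.1, ht.2]
  have hderiv : ∀ t ∈ Set.Icc (0 : ℝ) 1,
      HasDerivAt (fun t : ℝ => G (x + t • (y - x)) - G x) (G' (x + t • (y - x)) (y - x)) t := by
    intro t ht
    have hline : HasDerivAt (fun t : ℝ => x + t • (y - x)) (y - x) t := by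
      simpa using ((hasDerivAt_id t).smul_const (y - x)).const_add x
    exact ((hG _ (hmem t ht)).comp_hasDerivAt t hline).sub_const _
  have hB : ∀ t : ℝ, HasDerivAt (fun t : ℝ => L * (t * a + t ^ 2 * ((b - a) / 2)) * ‖y - x‖)
      (L * ((1 - t) * a + t * b) * ‖y - x‖) t := by
    intro t
    have h := (((hasDerivAt_id t).mul_const a).add
      ((hasDerivAt_pow 2 t).mul_const ((b - a) / 2))).const_mul L |>.mul_const ‖y - x‖
    refine h.congr_deriv ?_
    push_cast
    ring
  have key := image_norm_le_of_norm_deriv_right_le_deriv_boundary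
    (fun t ht => (hderiv t ht).continuousAt.continuousWithinAt)
    (fun t ht => (hderiv t (Set.Ico_subset_Icc_self ht)).hasDerivWithinAt)
    (by simp) hB (fun t ht => by
      have ht' := Set.Ico_subset_Icc_self ht
      exact (ContinuousLinearMap.le_opNorm _ _).trans (mul_le_mul_of_nonneg_right
        ((hbound _ (hmem t ht')).trans (mul_le_mul_of_nonneg_left (hnorm t ht') hL))
        (norm_nonneg _)))
    (Set.right_mem_Icc.2 zero_le_one)
  simp only [one_smul, add_sub_cancel] at key
  convert key using 2
  ring

/-- **Brezzi–Rappaz–Raviart a posteriori error bound.**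
Let `X`, `Y` be real Banach spaces, `p₀ ∈ X`, `R > 0`, and let `F : X → Y` be Fréchet
differentiable on the closed ball of radius `R` around `p₀`, with derivative `F'`.
Assume `F' p₀` is bijective with `β * ‖x‖ ≤ ‖F' p₀ x‖` for all `x`, that `F'` is Lipschitz
around `p₀` with constant `L` on the ball, that `R ≥ β / L`, and that `‖F p₀‖ ≤ r₁ + r₂`.
If `τ := 2 * L * (r₁ + r₂) / β ^ 2 < 1`, then there is a unique `p` in the closed ball of
radius `β / L` around `p₀` with `F p = 0`, and it satisfies
`‖p - p₀‖ ≤ (β / L) * (1 - √(1 - τ))`. -/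
theorem brezzi_rappaz_raviart_a_posteriori_bound
    {X Y : Type*} [NormedAddCommGroup X] [NormedSpace ℝ X] [CompleteSpace X]
    [NormedAddCommGroup Y] [NormedSpace ℝ Y] [CompleteSpace Y]
    (p₀ : X) (R : ℝ) (hR : 0 < R)
    (F : X → Y) (F' : X → X →L[ℝ] Y)
    (hdiff : ∀ w ∈ Metric.closedBall p₀ R, HasFDerivAt F (F' w) w)
    (β L : ℝ) (hβ : 0 < β) (hL : 0 < L)
    (hbij : Function.Bijective (F' p₀))
    (hinf : ∀ x : X, β * ‖x‖ ≤ ‖F' p₀ x‖)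
    (hlip : ∀ w ∈ Metric.closedBall p₀ R, ‖F' w - F' p₀‖ ≤ L * ‖w - p₀‖)
    (hRβL : β / L ≤ R)
    (r₁ r₂ : ℝ) (hr₁ : 0 ≤ r₁) (hr₂ : 0 ≤ r₂)
    (hres : ‖F p₀‖ ≤ r₁ + r₂)
    (τ : ℝ) (hτdef : τ = 2 * L * (r₁ + r₂) / β ^ 2) (hτ : τ < 1) :
    ∃ p ∈ Metric.closedBall p₀ (β / L), F p = 0 ∧
      ‖p - p₀‖ ≤ (β / L) * (1 - Real.sqrt (1 - τ)) ∧
      ∀ q ∈ Metric.closedBall p₀ (β / L), F q = 0 → q = p := by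
  obtain ⟨S, hS⟩ := hbij.surjective.hasRightInverse
  have hSlip (u : Y) (x : X) : β * ‖S u - x‖ ≤ ‖u - F' p₀ x‖ := by
    simpa [map_sub, hS u] using hinf (S u - x)
  have mean_value {x y : X} {a b : ℝ} (hx : ‖x - p₀‖ ≤ a) (hy : ‖y - p₀‖ ≤ b)
      (ha : a ≤ β / L) (hb : b ≤ β / L) :
      ‖(F y - F' p₀ y) - (F x - F' p₀ x)‖ ≤ L * ((a + b) / 2) * ‖y - x‖ :=
    norm_image_sub_le_of_norm_fderiv_le_mul_norm_sub (G := fun w => F w - F' p₀ w) hL.le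
      (fun w hw => (hdiff w hw).sub (F' p₀).hasFDerivAt) hlip hx hy
      (ha.trans hRβL) (hb.trans hRβL)
  set k := 1 - Real.sqrt (1 - τ) with hk
  have hτ0 : 0 ≤ τ := by rw [hτdef]; positivity
  have hk1 : k < 1 := by
    have := Real.sqrt_pos.2 (sub_pos.2 hτ)
    linarith
  have hk0 : 0 ≤ k := sub_nonneg.2 (Real.sqrt_le_one.2 (by linarith))
  set s := β / L * k with hs
  have hLs : L * s = β * k := by rw [hs]; field_simp
  have hα : 0 < β / L := div_pos hβ hL
  have hs0 : 0 ≤ s := mul_nonneg hα.le hk0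
  have hsα : s < β / L := mul_lt_of_lt_one_right hα hk1
  have hroot : L * s ^ 2 / 2 + (r₁ + r₂) = β * s := by
    have hquad : 2 * k - k ^ 2 = τ := by
      have := Real.sq_sqrt (sub_nonneg.2 hτ.le)
      rw [hk]
      linarith
    rw [hτdef, eq_div_iff (by positivity)] at hquad
    rw [hs]
    field_simp
    linarith
  let T : X → X := fun w => S (F' p₀ w - F w)
  have hmaps : Set.MapsTo T (Metric.closedBall p₀ s) (Metric.closedBall p₀ s) := by
    intro w hw
    rw [mem_closedBall_iff_norm] at hw ⊢
    refine le_of_mul_le_mul_left ?_ hβ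
    calc β * ‖T w - p₀‖ ≤ ‖F' p₀ w - F w - F' p₀ p₀‖ := hSlip _ _
      _ = ‖(F w - F' p₀ w) - (F p₀ - F' p₀ p₀) + F p₀‖ := by
          rw [← norm_neg]; congr 1; abel
      _ ≤ L * ((0 + s) / 2) * ‖w - p₀‖ + (r₁ + r₂) :=
          (norm_add_le _ _).trans
            (add_le_add (mean_value (by simp) hw hα.le hsα.le) hres)
      _ ≤ L * ((0 + s) / 2) * s + (r₁ + r₂) := by gcongr
      _ = β * s := by rw [← hroot]; ring
  have hcontr : ContractingWith ⟨k, hk0⟩ (hmaps.restrict T _ _) := by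
    refine ⟨hk1, LipschitzWith.of_dist_le_mul fun x y => ?_⟩
    have hx := mem_closedBall_iff_norm.1 x.2
    have hy := mem_closedBall_iff_norm.1 y.2
    change dist (T x) (T y) ≤ k * dist (x : X) y
    rw [dist_eq_norm, dist_eq_norm]
    refine le_of_mul_le_mul_left ?_ hβ
    calc β * ‖T x - T y‖ ≤ ‖F' p₀ x - F x - F' p₀ (T y)‖ := hSlip _ _
      _ = ‖(F x - F' p₀ x) - (F y - F' p₀ y)‖ := by
          rw [hS, ← norm_neg]; congr 1; abel
      _ ≤ L * ((s + s) / 2) * ‖(x : X) - y‖ := mean_value hy hx hsα.le hsα.le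
      _ = β * (k * ‖(x : X) - y‖) := by rw [add_self_div_two, hLs, mul_assoc]
  obtain ⟨p, hps, hp, -⟩ := hcontr.exists_fixedPoint' Metric.isClosed_closedBall.isComplete hmaps
    (Metric.mem_closedBall_self hs0) (edist_ne_top _ _)
  have hFp : F p = 0 := by
    have h : F' p₀ (T p) = F' p₀ p - F p := hS _
    rw [hp.eq] at h
    exact sub_eq_self.1 h.symm
  refine ⟨p, Metric.closedBall_subset_closedBall hsα.le hps, hFp,
    mem_closedBall_iff_norm.1 hps, fun q hq hFq => ?_⟩
  have hqp : β * ‖q - p‖ ≤ L * ((s + β / L) / 2) * ‖q - p‖ := by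
    refine (hinf (q - p)).trans ?_
    have h := mean_value (mem_closedBall_iff_norm.1 hps) (mem_closedBall_iff_norm.1 hq)
      hsα.le le_rfl
    rwa [hFq, hFp, zero_sub, zero_sub, ← neg_sub', norm_neg, ← map_sub] at h
  have hlt : L * ((s + β / L) / 2) < β := by
    have : L * (β / L) = β := mul_div_cancel₀ β hL.ne'
    nlinarith
  by_contra hne
  exact absurd hqp (not_le.2 (mul_lt_mul_of_pos_right hlt (norm_sub_pos_iff.2 hne)))
end

section
/- (Effectivity of the Brezzi–Rappaz–Raviart error bound.) Assume the Banach-space setting below with R ≥ β/L, and additionally let γ := ‖F'(p₀)‖_{X→Y}. Suppose there exists g ∈ Y with r₁ = ‖F(p₀) − g‖_Y, r₂ = ‖g‖_Y and ‖F(p₀) − g‖_Y ≤ c_err ‖g‖_Y for some c_err ∈ [0,1); set C_err := (1 − c_err)/(1 + c_err) and τ := 2L(r₁ + r₂)/β². If τ ≤ C_err/2, then the error estimator Δ := (β/L)(1 − √(1 − τ)) satisfies Δ ≤ 4 C_err^{−1} (γ/β) ‖p − p₀‖_X, where p is the unique zero of F in B̄(p₀, β/L). -/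
/-- If `F'` is Lipschitz at `p₀` with constant `L` on a ball containing `p`, then the linearization
of `F` at `p₀` approximates `F p` up to `L * ‖p - p₀‖ ^ 2`. -/
theorem norm_sub_sub_fderiv_le_of_lipschitz_at
    {X Y : Type*} [NormedAddCommGroup X] [NormedSpace ℝ X]
    [NormedAddCommGroup Y] [NormedSpace ℝ Y]
    {p₀ p : X} {R L : ℝ} {F : X → Y} {F' : X → X →L[ℝ] Y} (hL : 0 ≤ L)
    (hdiff : ∀ w ∈ Metric.closedBall p₀ R, HasFDerivAt F (F' w) w)
    (hlip : ∀ w ∈ Metric.closedBall p₀ R, ‖F' w - F' p₀‖ ≤ L * ‖w - p₀‖)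
    (hp : ‖p - p₀‖ ≤ R) :
    ‖F p - F p₀ - F' p₀ (p - p₀)‖ ≤ L * ‖p - p₀‖ * ‖p - p₀‖ := by
  have hsub : Metric.closedBall p₀ ‖p - p₀‖ ⊆ Metric.closedBall p₀ R :=
    Metric.closedBall_subset_closedBall hp
  refine (convex_closedBall p₀ ‖p - p₀‖).norm_image_sub_le_of_norm_hasFDerivWithin_le'
    (fun w hw => (hdiff w (hsub hw)).hasFDerivWithinAt) (fun w hw => ?_)
    (Metric.mem_closedBall_self (norm_nonneg _)) (mem_closedBall_iff_norm.2 le_rfl)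
  exact (hlip w (hsub hw)).trans
    (mul_le_mul_of_nonneg_left (mem_closedBall_iff_norm.1 hw) hL)

/-- A relative error bound `‖y - g‖ ≤ c * ‖g‖` with `c < 1` controls `‖y - g‖ + ‖g‖` by `‖y‖`. -/
theorem norm_sub_add_norm_le_of_relative_error
    {Y : Type*} [NormedAddCommGroup Y] {y g : Y} {c : ℝ} (hc0 : 0 ≤ c) (hc1 : c < 1)
    (h : ‖y - g‖ ≤ c * ‖g‖) :
    ‖y - g‖ + ‖g‖ ≤ ((1 - c) / (1 + c))⁻¹ * ‖y‖ := by
  have hg : (1 - c) * ‖g‖ ≤ ‖y‖ := by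
    have := norm_sub_norm_le g y
    rw [norm_sub_rev] at this
    linarith
  have hc : 0 < 1 - c := by linarith
  rw [inv_div, div_mul_eq_mul_div, le_div_iff₀ hc]
  nlinarith [mul_le_mul_of_nonneg_left hg (show 0 ≤ 1 + c by linarith),
    mul_le_mul_of_nonneg_left h hc.le]

theorem one_sub_sqrt_one_sub_le {t : ℝ} (h0 : 0 ≤ t) (h1 : t ≤ 1) : 1 - √(1 - t) ≤ t := by
  have : 1 - t ≤ √(1 - t) := Real.le_sqrt_of_sq_le (by nlinarith)
  linarith

/-- **Effectivity of the Brezzi–Rappaz–Raviart error bound.**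
In the Brezzi–Rappaz–Raviart setting (Banach spaces `X`, `Y`, `F` differentiable on the closed
ball of radius `R ≥ β / L` around `p₀`, inf-sup bound `β`, Lipschitz constant `L` for `F'`),
let `γ := ‖F' p₀‖`.  Suppose `g ∈ Y` satisfies `r₁ = ‖F p₀ - g‖`, `r₂ = ‖g‖` and
`‖F p₀ - g‖ ≤ c_err * ‖g‖` with `c_err ∈ [0,1)`; set `C_err := (1 - c_err)/(1 + c_err)` and
`τ := 2 * L * (r₁ + r₂) / β ^ 2`.  If `τ ≤ C_err / 2`, then the error estimator
`Δ := (β / L) * (1 - √(1 - τ))` satisfies `Δ ≤ 4 * C_err⁻¹ * (γ / β) * ‖p - p₀‖`,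
where `p` is the (unique) zero of `F` in the closed ball of radius `β / L` around `p₀`. -/
theorem brezzi_rappaz_raviart_effectivity
    {X Y : Type*} [NormedAddCommGroup X] [NormedSpace ℝ X] [CompleteSpace X]
    [NormedAddCommGroup Y] [NormedSpace ℝ Y] [CompleteSpace Y]
    (p₀ : X) (R : ℝ) (hR : 0 < R)
    (F : X → Y) (F' : X → X →L[ℝ] Y)
    (hdiff : ∀ w ∈ Metric.closedBall p₀ R, HasFDerivAt F (F' w) w)
    (β L : ℝ) (hβ : 0 < β) (hL : 0 < L)
    (hbij : Function.Bijective (F' p₀))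
    (hinf : ∀ x : X, β * ‖x‖ ≤ ‖F' p₀ x‖)
    (hlip : ∀ w ∈ Metric.closedBall p₀ R, ‖F' w - F' p₀‖ ≤ L * ‖w - p₀‖)
    (hRβL : β / L ≤ R)
    (γ : ℝ) (hγ : γ = ‖F' p₀‖)
    (g : Y) (c_err : ℝ) (hc0 : 0 ≤ c_err) (hc1 : c_err < 1)
    (r₁ r₂ : ℝ) (hr₁ : r₁ = ‖F p₀ - g‖) (hr₂ : r₂ = ‖g‖)
    (hce : ‖F p₀ - g‖ ≤ c_err * ‖g‖)
    (τ : ℝ) (hτdef : τ = 2 * L * (r₁ + r₂) / β ^ 2)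
    (hτ : τ ≤ ((1 - c_err) / (1 + c_err)) / 2) :
    ∀ p ∈ Metric.closedBall p₀ (β / L), F p = 0 →
      (β / L) * (1 - Real.sqrt (1 - τ)) ≤
        4 * ((1 - c_err) / (1 + c_err))⁻¹ * (γ / β) * ‖p - p₀‖ := by
  intro p hp hFp
  have he : ‖p - p₀‖ ≤ β / L := mem_closedBall_iff_norm.1 hp
  have hlin := norm_sub_sub_fderiv_le_of_lipschitz_at hL.le hdiff hlip (he.trans hRβL)
  have hop : ‖F' p₀ (p - p₀)‖ ≤ γ * ‖p - p₀‖ := hγ ▸ (F' p₀).le_opNorm _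
  have hLe : L * ‖p - p₀‖ ≤ β := by rwa [le_div_iff₀' hL] at he
  have hres : ‖F p₀‖ ≤ 2 * (γ * ‖p - p₀‖) := by
    have htri := norm_le_norm_add_norm_sub' (F p₀) (-F' p₀ (p - p₀))
    have heq : ‖F p₀ - -F' p₀ (p - p₀)‖ = ‖F p - F p₀ - F' p₀ (p - p₀)‖ := by
      rw [← norm_neg, hFp]
      congr 1
      abel
    rw [heq, norm_neg] at htri
    linarith [mul_le_mul_of_nonneg_right hLe (norm_nonneg (p - p₀)), hinf (p - p₀)]
  have hsum := norm_sub_add_norm_le_of_relative_error hc0 hc1 hce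
  rw [← hr₁, ← hr₂] at hsum
  have hC0 : 0 ≤ (1 - c_err) / (1 + c_err) := div_nonneg (by linarith) (by linarith)
  have hC1 : (1 - c_err) / (1 + c_err) ≤ 1 := (div_le_one (by linarith)).2 (by linarith)
  have hτ0 : 0 ≤ τ := by
    rw [hτdef, hr₁, hr₂]
    positivity
  calc (β / L) * (1 - √(1 - τ)) ≤ (β / L) * τ :=
        mul_le_mul_of_nonneg_left (one_sub_sqrt_one_sub_le hτ0 (by linarith)) (by positivity)
    _ = 2 / β * (r₁ + r₂) := by
        rw [hτdef]
        field_simp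
    _ ≤ 2 / β * (((1 - c_err) / (1 + c_err))⁻¹ * (2 * (γ * ‖p - p₀‖))) := by
        gcongr
        exact hsum.trans (mul_le_mul_of_nonneg_left hres (inv_nonneg.2 hC0))
    _ = 4 * ((1 - c_err) / (1 + c_err))⁻¹ * (γ / β) * ‖p - p₀‖ := by ring
end
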